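/- Let n ≥ 1 and let Z̄_n = n⁻¹∑_{i=1}^n Z_i be the mean of n independent random variables each with law PN(μ_X,μ_Y;σ_X²,σ_Y²;ρ). Then for every function f : ℝ → ℝ of class C⁴ such that E|f^{(m)}(Z̄_n)| < ∞ for m = 0,1,2,3 and E|Z̄_n·f^{(m)}(Z̄_n)| < ∞ for m = 0,1,2,3,4, one has E[A₁f(Z̄_n)] = 0. -/

import Mathlib

open MeasureTheory ProbabilityTheory

/-- The product-normal law `PN(μX, μY; σX², σY²; ρ)`: the law of `X * Y` where
`X = μX + σX * U`, `Y = μY + σY * (ρ * U + √(1 - ρ²) * V)` and `U, V` are independent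
standard normal random variables. -/
noncomputable def PN (μX μY σX σY ρ : ℝ) : Measure ℝ :=
  Measure.map
    (fun p : ℝ × ℝ =>
      (μX + σX * p.1) * (μY + σY * (ρ * p.1 + Real.sqrt (1 - ρ ^ 2) * p.2)))
    ((gaussianReal 0 1).prod (gaussianReal 0 1))

/-- The law of the mean `Z̄ₙ = n⁻¹ ∑ᵢ Zᵢ` of `n` independent random variables with law
`PN(μX, μY; σX², σY²; ρ)`. -/
noncomputable def PNbar (n : ℕ) (μX μY σX σY ρ : ℝ) : Measure ℝ :=
  Measure.map (fun ω : Fin n → ℝ => (∑ i, ω i) / (n : ℝ))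
    (Measure.pi fun _ : Fin n => PN μX μY σX σY ρ)

/-- The fourth-order Stein operator `A₁` (with `s_n = σXσY/n`, `r_X = μX/σX`, `r_Y = μY/σY`). -/
noncomputable def A1 (n : ℕ) (μX μY σX σY ρ : ℝ) (f : ℝ → ℝ) (x : ℝ) : ℝ :=
  (σX * σY / (n : ℝ)) ^ 4 * (1 - ρ ^ 2) ^ 2 * x * iteratedDeriv 4 f x
    + (σX * σY / (n : ℝ)) ^ 3 * (1 - ρ ^ 2)
        * ((n : ℝ) * (σX * σY / (n : ℝ)) * (1 - ρ ^ 2) + 4 * ρ * x) * iteratedDeriv 3 f x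
    + (σX * σY / (n : ℝ)) ^ 2
        * ((n : ℝ) * (σX * σY / (n : ℝ)) * (ρ * ((μX / σX) ^ 2 + (μY / σY) ^ 2)
              - (1 + ρ ^ 2) * (μX / σX) * (μY / σY) + 3 * ρ * (1 - ρ ^ 2))
            + (6 * ρ ^ 2 - 2) * x) * iteratedDeriv 2 f x
    + (σX * σY / (n : ℝ))
        * ((n : ℝ) * (σX * σY / (n : ℝ)) * (2 * ρ * (μX / σX) * (μY / σY) - (μX / σX) ^ 2
              - (μY / σY) ^ 2 + 3 * ρ ^ 2 - 1) - 4 * ρ * x) * iteratedDeriv 1 f x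
    + (x - μX * μY - (n : ℝ) * (σX * σY / (n : ℝ)) * ρ) * f x


lemma hasDerivAt_gaussianPDFReal_zero_one (x : ℝ) :
    HasDerivAt (gaussianPDFReal 0 1) (-x * gaussianPDFReal 0 1 x) x := by
  have h1 : HasDerivAt (fun t : ℝ => -(t - 0) ^ 2 / (2 * ((1 : NNReal) : ℝ))) (-x) x := by
    have h := ((((hasDerivAt_id x).sub_const 0).pow 2).neg).div_const (2 * ((1 : NNReal) : ℝ))
    refine h.congr_deriv ?_
    simp
    ring
  have h2 := (h1.exp).const_mul ((√(2 * Real.pi * ((1 : NNReal) : ℝ)))⁻¹)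
  rw [gaussianPDFReal_def]
  refine h2.congr_deriv ?_
  ring

lemma integrable_gaussianReal_iff {f : ℝ → ℝ} :
    Integrable f (gaussianReal 0 1) ↔ Integrable (fun x => gaussianPDFReal 0 1 x * f x) := by
  rw [gaussianReal_of_var_ne_zero _ one_ne_zero,
    integrable_withDensity_iff_integrable_smul' (measurable_gaussianPDF 0 1)
      (ae_of_all _ fun _ => gaussianPDF_lt_top)]
  simp [toReal_gaussianPDF]

lemma integral_mul_gaussianReal_eq_integral_deriv {h h' : ℝ → ℝ}
    (hd : ∀ x, HasDerivAt h (h' x) x) (hi : Integrable h (gaussianReal 0 1))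
    (hi' : Integrable h' (gaussianReal 0 1))
    (hxi : Integrable (fun x => x * h x) (gaussianReal 0 1)) :
    ∫ x, x * h x ∂gaussianReal 0 1 = ∫ x, h' x ∂gaussianReal 0 1 := by
  rw [integrable_gaussianReal_iff] at hi hi' hxi
  rw [integral_gaussianReal_eq_integral_smul one_ne_zero,
    integral_gaussianReal_eq_integral_smul one_ne_zero]
  have key := integral_mul_deriv_eq_deriv_mul_of_integrable (u := h) (v := gaussianPDFReal 0 1)
    (fun x _ => hd x) (fun x _ => hasDerivAt_gaussianPDFReal_zero_one x)
    (hxi.neg.congr (ae_of_all _ fun x => by simp; ring))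
    (hi'.congr (ae_of_all _ fun x => by simp [mul_comm]))
    (hi.congr (ae_of_all _ fun x => by simp [mul_comm]))
  calc ∫ x, gaussianPDFReal 0 1 x • (x * h x)
      = -∫ x, h x * (-x * gaussianPDFReal 0 1 x) := by
        rw [← integral_neg]; congr 1; ext x; simp only [smul_eq_mul]; ring
    _ = ∫ x, gaussianPDFReal 0 1 x • h' x := by
        rw [key, neg_neg]; simp only [smul_eq_mul, mul_comm]

lemma integral_fst_mul_sub_deriv {h h' : ℝ × ℝ → ℝ}
    (hd : ∀ p : ℝ × ℝ, HasDerivAt (fun t => h (t, p.2)) (h' p) p.1)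
    (hi : Integrable h ((gaussianReal 0 1).prod (gaussianReal 0 1)))
    (hi' : Integrable h' ((gaussianReal 0 1).prod (gaussianReal 0 1)))
    (hxi : Integrable (fun p => p.1 * h p) ((gaussianReal 0 1).prod (gaussianReal 0 1))) :
    ∫ p, (p.1 * h p - h' p) ∂(gaussianReal 0 1).prod (gaussianReal 0 1) = 0 := by
  rw [integral_sub hxi hi', sub_eq_zero, integral_prod_symm _ hxi, integral_prod_symm _ hi']
  refine integral_congr_ae ?_
  filter_upwards [hi.prod_left_ae, hi'.prod_left_ae, hxi.prod_left_ae] with v h1 h2 h3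
  exact integral_mul_gaussianReal_eq_integral_deriv (fun u => hd (u, v)) h1 h2 h3

lemma integral_snd_mul_sub_deriv {h h' : ℝ × ℝ → ℝ}
    (hd : ∀ p : ℝ × ℝ, HasDerivAt (fun t => h (p.1, t)) (h' p) p.2)
    (hi : Integrable h ((gaussianReal 0 1).prod (gaussianReal 0 1)))
    (hi' : Integrable h' ((gaussianReal 0 1).prod (gaussianReal 0 1)))
    (hxi : Integrable (fun p => p.2 * h p) ((gaussianReal 0 1).prod (gaussianReal 0 1))) :
    ∫ p, (p.2 * h p - h' p) ∂(gaussianReal 0 1).prod (gaussianReal 0 1) = 0 := by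
  rw [integral_sub hxi hi', sub_eq_zero, integral_prod _ hxi, integral_prod _ hi']
  refine integral_congr_ae ?_
  filter_upwards [hi.prod_right_ae, hi'.prod_right_ae, hxi.prod_right_ae] with u h1 h2 h3
  exact integral_mul_gaussianReal_eq_integral_deriv (fun v => hd (u, v)) h1 h2 h3

lemma memLp_two_affine (a₀ a₁ a₂ : ℝ) :
    MemLp (fun p : ℝ × ℝ => a₀ + a₁ * p.1 + a₂ * p.2) 2
      ((gaussianReal 0 1).prod (gaussianReal 0 1)) := by
  have h : MemLp (id : ℝ → ℝ) 2 (gaussianReal 0 1) := memLp_id_gaussianReal 2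
  exact ((memLp_const a₀).add ((h.comp_fst (gaussianReal 0 1)).const_mul a₁)).add
    ((h.comp_snd (gaussianReal 0 1)).const_mul a₂)

lemma integrable_affine_mul_affine_mul_bdd (a₀ a₁ a₂ b₀ b₁ b₂ : ℝ) {k : ℝ × ℝ → ℝ} {C : ℝ}
    (hk : Continuous k) (hC : ∀ p, |k p| ≤ C) :
    Integrable (fun p : ℝ × ℝ => (a₀ + a₁ * p.1 + a₂ * p.2) * (b₀ + b₁ * p.1 + b₂ * p.2) * k p)
      ((gaussianReal 0 1).prod (gaussianReal 0 1)) :=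
  ((memLp_two_affine a₀ a₁ a₂).integrable_mul (memLp_two_affine b₀ b₁ b₂)).mul_bdd
    hk.aestronglyMeasurable (ae_of_all _ hC)

section GaussianPair

variable {a b ρ c s w α β C C' : ℝ} {k k' : ℝ → ℝ}

lemma stein_term_fst (hd : ∀ x, HasDerivAt k (k' x) x) (hk' : Continuous k')
    (hC : ∀ x, |k x| ≤ C) (hC' : ∀ x, |k' x| ≤ C') :
    let T := fun p : ℝ × ℝ =>
      p.1 * ((α + β * (b + (ρ * p.1 + c * p.2)))
          * k (s * ((a + p.1) * (b + (ρ * p.1 + c * p.2))) + w))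
        - (β * ρ * k (s * ((a + p.1) * (b + (ρ * p.1 + c * p.2))) + w)
          + (α + β * (b + (ρ * p.1 + c * p.2)))
            * (s * (b + (ρ * p.1 + c * p.2) + ρ * (a + p.1)))
            * k' (s * ((a + p.1) * (b + (ρ * p.1 + c * p.2))) + w))
    Integrable T ((gaussianReal 0 1).prod (gaussianReal 0 1)) ∧
      ∫ p, T p ∂(gaussianReal 0 1).prod (gaussianReal 0 1) = 0 := by
  have hk : Continuous k := continuous_iff_continuousAt.2 fun x => (hd x).continuousAt
  have hr : Continuous fun p : ℝ × ℝ => s * ((a + p.1) * (b + (ρ * p.1 + c * p.2))) + w := by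
    fun_prop
  have hi (a₀ a₁ a₂ b₀ b₁ b₂ : ℝ) := integrable_affine_mul_affine_mul_bdd a₀ a₁ a₂ b₀ b₁ b₂
    (hk.comp hr) (fun p => hC _)
  have hi' (a₀ a₁ a₂ b₀ b₁ b₂ : ℝ) := integrable_affine_mul_affine_mul_bdd a₀ a₁ a₂ b₀ b₁ b₂
    (hk'.comp hr) (fun p => hC' _)
  have h1 := (hi 1 0 0 (α + β * b) (β * ρ) (β * c)).congr
    (g := fun p : ℝ × ℝ => (α + β * (b + (ρ * p.1 + c * p.2)))
      * k (s * ((a + p.1) * (b + (ρ * p.1 + c * p.2))) + w))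
    (ae_of_all _ fun p => by simp only [Function.comp]; ring)
  have h2 := ((hi 1 0 0 (β * ρ) 0 0).add (hi' (α + β * b) (β * ρ) (β * c)
    (s * (b + ρ * a)) (s * (2 * ρ)) (s * c))).congr
    (g := fun p : ℝ × ℝ => β * ρ * k (s * ((a + p.1) * (b + (ρ * p.1 + c * p.2))) + w)
          + (α + β * (b + (ρ * p.1 + c * p.2)))
            * (s * (b + (ρ * p.1 + c * p.2) + ρ * (a + p.1)))
            * k' (s * ((a + p.1) * (b + (ρ * p.1 + c * p.2))) + w))
    (ae_of_all _ fun p => by simp only [Function.comp, Pi.add_apply]; ring)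
  have h3 := (hi 0 1 0 (α + β * b) (β * ρ) (β * c)).congr
    (g := fun p : ℝ × ℝ => p.1 * ((α + β * (b + (ρ * p.1 + c * p.2)))
      * k (s * ((a + p.1) * (b + (ρ * p.1 + c * p.2))) + w)))
    (ae_of_all _ fun p => by simp only [Function.comp]; ring)
  refine ⟨h3.sub h2, integral_fst_mul_sub_deriv (fun p => ?_) h1 h2 h3⟩
  have hY : HasDerivAt (fun t => b + (ρ * t + c * p.2)) ρ p.1 := by
    simpa using (((hasDerivAt_id p.1).const_mul ρ).add_const (c * p.2)).const_add b
  have hX : HasDerivAt (fun t => a + t) 1 p.1 := (hasDerivAt_id p.1).const_add a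
  have hK := (hd (s * ((a + p.1) * (b + (ρ * p.1 + c * p.2))) + w)).comp p.1
    (((hX.mul hY).const_mul s).add_const w)
  refine (((hY.const_mul β).const_add α).mul hK).congr_deriv ?_
  simp only [Function.comp, Pi.mul_apply]
  ring

lemma stein_term_snd (hd : ∀ x, HasDerivAt k (k' x) x) (hk' : Continuous k')
    (hC : ∀ x, |k x| ≤ C) (hC' : ∀ x, |k' x| ≤ C') :
    let T := fun p : ℝ × ℝ =>
      p.2 * ((α + β * (b + (ρ * p.1 + c * p.2)))
          * k (s * ((a + p.1) * (b + (ρ * p.1 + c * p.2))) + w))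
        - (β * c * k (s * ((a + p.1) * (b + (ρ * p.1 + c * p.2))) + w)
          + (α + β * (b + (ρ * p.1 + c * p.2))) * (s * (c * (a + p.1)))
            * k' (s * ((a + p.1) * (b + (ρ * p.1 + c * p.2))) + w))
    Integrable T ((gaussianReal 0 1).prod (gaussianReal 0 1)) ∧
      ∫ p, T p ∂(gaussianReal 0 1).prod (gaussianReal 0 1) = 0 := by
  have hk : Continuous k := continuous_iff_continuousAt.2 fun x => (hd x).continuousAt
  have hr : Continuous fun p : ℝ × ℝ => s * ((a + p.1) * (b + (ρ * p.1 + c * p.2))) + w := by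
    fun_prop
  have hi (a₀ a₁ a₂ b₀ b₁ b₂ : ℝ) := integrable_affine_mul_affine_mul_bdd a₀ a₁ a₂ b₀ b₁ b₂
    (hk.comp hr) (fun p => hC _)
  have hi' (a₀ a₁ a₂ b₀ b₁ b₂ : ℝ) := integrable_affine_mul_affine_mul_bdd a₀ a₁ a₂ b₀ b₁ b₂
    (hk'.comp hr) (fun p => hC' _)
  have h1 := (hi 1 0 0 (α + β * b) (β * ρ) (β * c)).congr
    (g := fun p : ℝ × ℝ => (α + β * (b + (ρ * p.1 + c * p.2)))
      * k (s * ((a + p.1) * (b + (ρ * p.1 + c * p.2))) + w))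
    (ae_of_all _ fun p => by simp only [Function.comp]; ring)
  have h2 := ((hi 1 0 0 (β * c) 0 0).add (hi' (α + β * b) (β * ρ) (β * c)
    (s * (c * a)) (s * c) 0)).congr
    (g := fun p : ℝ × ℝ => β * c * k (s * ((a + p.1) * (b + (ρ * p.1 + c * p.2))) + w)
          + (α + β * (b + (ρ * p.1 + c * p.2))) * (s * (c * (a + p.1)))
            * k' (s * ((a + p.1) * (b + (ρ * p.1 + c * p.2))) + w))
    (ae_of_all _ fun p => by simp only [Function.comp, Pi.add_apply]; ring)
  have h3 := (hi 0 0 1 (α + β * b) (β * ρ) (β * c)).congr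
    (g := fun p : ℝ × ℝ => p.2 * ((α + β * (b + (ρ * p.1 + c * p.2)))
      * k (s * ((a + p.1) * (b + (ρ * p.1 + c * p.2))) + w)))
    (ae_of_all _ fun p => by simp only [Function.comp]; ring)
  refine ⟨h3.sub h2, integral_snd_mul_sub_deriv (fun p => ?_) h1 h2 h3⟩
  have hY : HasDerivAt (fun t => b + (ρ * p.1 + c * t)) c p.2 := by
    simpa using (((hasDerivAt_id p.2).const_mul c).const_add (ρ * p.1)).const_add b
  have hK := (hd (s * ((a + p.1) * (b + (ρ * p.1 + c * p.2))) + w)).comp p.2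
    (((hY.const_mul (a + p.1)).const_mul s).add_const w)
  refine (((hY.const_mul β).const_add α).mul hK).congr_deriv ?_
  simp only [Function.comp]
  ring

/-- The Stein identity for the product of two standardised correlated normal variables with
means `a`, `b`, tested against derivatives evaluated at an affine function of the product. -/
lemma integral_stein_gaussian_prod (hc : c ^ 2 = 1 - ρ ^ 2) {g : ℝ → ℝ} (hg : ContDiff ℝ 4 g)
    (hb : ∀ m ≤ 4, ∃ C, ∀ x, |iteratedDeriv m g x| ≤ C) :
    ∫ p : ℝ × ℝ, (fun z x : ℝ =>
        s ^ 4 * (1 - ρ ^ 2) ^ 2 * z * iteratedDeriv 4 g x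
        + s ^ 3 * (1 - ρ ^ 2) * ((1 - ρ ^ 2) + 4 * ρ * z) * iteratedDeriv 3 g x
        + s ^ 2 * (ρ * (a ^ 2 + b ^ 2) - (1 + ρ ^ 2) * a * b + 3 * ρ * (1 - ρ ^ 2)
          + (6 * ρ ^ 2 - 2) * z) * iteratedDeriv 2 g x
        + s * (2 * ρ * a * b - a ^ 2 - b ^ 2 + 3 * ρ ^ 2 - 1 - 4 * ρ * z) * iteratedDeriv 1 g x
        + (z - a * b - ρ) * g x)
      ((a + p.1) * (b + (ρ * p.1 + c * p.2)))
      (s * ((a + p.1) * (b + (ρ * p.1 + c * p.2))) + w)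
      ∂(gaussianReal 0 1).prod (gaussianReal 0 1) = 0 := by
  have hd (m : ℕ) (hm : m < 4) (x : ℝ) :
      HasDerivAt (iteratedDeriv m g) (iteratedDeriv (m + 1) g x) x := by
    rw [iteratedDeriv_succ]
    exact (hg.differentiable_iteratedDeriv m (by exact_mod_cast hm) x).hasDerivAt
  have hcont (m : ℕ) (hm : m < 4) : Continuous (iteratedDeriv (m + 1) g) :=
    hg.continuous_iteratedDeriv (m + 1) (by exact_mod_cast hm)
  have t1 (m : ℕ) (hm : m < 4) (α β : ℝ) := stein_term_fst (a := a) (b := b) (ρ := ρ) (c := c)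
    (s := s) (w := w) (α := α) (β := β) (hd m hm) (hcont m hm) (hb m hm.le).choose_spec
    (hb (m + 1) hm).choose_spec
  have t2 (m : ℕ) (hm : m < 4) (α β : ℝ) := stein_term_snd (a := a) (b := b) (ρ := ρ) (c := c)
    (s := s) (w := w) (α := α) (β := β) (hd m hm) (hcont m hm) (hb m hm.le).choose_spec
    (hb (m + 1) hm).choose_spec
  obtain ⟨i0, e0⟩ := t1 0 (by norm_num) (ρ * a) 1
  obtain ⟨i1, e1⟩ := t1 1 (by norm_num) (s * (a + ρ * (b - 2 * ρ * a))) (s * (-2 * ρ))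
  obtain ⟨i2, e2⟩ := t1 2 (by norm_num) (s ^ 2 * ((1 - ρ ^ 2) * (b - ρ * a)))
    (s ^ 2 * (-(1 - ρ ^ 2)))
  obtain ⟨j0, d0⟩ := t2 0 (by norm_num) (c * a) 0
  obtain ⟨j1, d1⟩ := t2 1 (by norm_num) (s * (c * (b - 2 * ρ * a))) (s * c)
  obtain ⟨j2, d2⟩ := t2 2 (by norm_num) (s ^ 2 * (c * (-ρ * (b - ρ * a)))) (s ^ 2 * (c * (-2 * ρ)))
  obtain ⟨j3, d3⟩ := t2 3 (by norm_num) 0 (s ^ 3 * (c * (-(1 - ρ ^ 2))))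
  have key := integral_add (i0.add (i1.add (i2.add (j0.add (j1.add j2))))) j3
  rw [integral_add' i0 (i1.add (i2.add (j0.add (j1.add j2)))),
    integral_add' i1 (i2.add (j0.add (j1.add j2))), integral_add' i2 (j0.add (j1.add j2)),
    integral_add' j0 (j1.add j2), integral_add' j1 j2, e0, e1, e2, d0, d1, d2, d3] at key
  refine Eq.trans (integral_congr_ae (ae_of_all _ fun p => ?_)) (key.trans (by norm_num))
  simp only [Pi.add_apply, iteratedDeriv_zero, zero_add, Nat.reduceAdd]
  generalize iteratedDeriv 1 g _ = F1
  generalize iteratedDeriv 2 g _ = F2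
  generalize iteratedDeriv 3 g _ = F3
  generalize iteratedDeriv 4 g _ = F4
  generalize g _ = F0
  grind

end GaussianPair

section CutOff

open Filter Topology

lemma HasCompactSupport.iteratedDeriv_real {f : ℝ → ℝ} (hf : HasCompactSupport f) (m : ℕ) :
    HasCompactSupport (iteratedDeriv m f) := by
  induction m with
  | zero => simpa using hf
  | succ m ih => rw [iteratedDeriv_succ]; exact ih.deriv

lemma HasCompactSupport.exists_bound_iteratedDeriv {f : ℝ → ℝ} (hf : HasCompactSupport f)
    {m : ℕ} (hm : ContDiff ℝ m f) : ∃ C, ∀ x, |iteratedDeriv m f x| ≤ C :=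
  (hf.iteratedDeriv_real m).exists_bound_of_continuous (hm.continuous_iteratedDeriv m le_rfl)

lemma exists_smooth_cutoff : ∃ χ : ℝ → ℝ, (∀ m : ℕ, ContDiff ℝ m χ) ∧ HasCompactSupport χ ∧
    χ 0 = 1 := by
  let b : ContDiffBump (0 : ℝ) := ⟨1, 2, one_pos, one_lt_two⟩
  exact ⟨b, fun m => b.contDiff, b.hasCompactSupport,
    b.one_of_mem_closedBall (by simp [b.rIn_pos.le])⟩

lemma contDiff_mul_cutoff {f χ : ℝ → ℝ} {m : ℕ} (hf : ContDiff ℝ m f) (hχ : ContDiff ℝ m χ)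
    (c : ℝ) : ContDiff ℝ m (fun x => f x * χ (c * x)) :=
  hf.mul (hχ.comp (contDiff_const.mul contDiff_id))

lemma iteratedDeriv_mul_cutoff {f χ : ℝ → ℝ} {m : ℕ} (hf : ContDiff ℝ m f)
    (hχ : ∀ m : ℕ, ContDiff ℝ m χ) (c x : ℝ) :
    iteratedDeriv m (fun x => f x * χ (c * x)) x =
      ∑ i ∈ Finset.range (m + 1), m.choose i * iteratedDeriv i f x *
        (c ^ (m - i) * iteratedDeriv (m - i) χ (c * x)) := by
  have h : ContDiff ℝ m (fun x => χ (c * x)) := (hχ m).comp (contDiff_const.mul contDiff_id)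
  rw [iteratedDeriv_fun_mul hf.contDiffAt h.contDiffAt]
  refine Finset.sum_congr rfl fun i _ => ?_
  rw [iteratedDeriv_comp_const_mul (hχ _)]

lemma tendsto_integral_mul_iteratedDeriv_cutoff {μ : Measure ℝ} {v f χ : ℝ → ℝ} {m : ℕ}
    (hv : Continuous v) (hf : ContDiff ℝ m f) (hχ : ∀ m : ℕ, ContDiff ℝ m χ)
    (hsupp : HasCompactSupport χ) (hχ0 : χ 0 = 1)
    (hint : ∀ j ≤ m, Integrable (fun x => v x * iteratedDeriv j f x) μ) :
    Tendsto (fun R : ℕ => ∫ x, v x *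
        iteratedDeriv m (fun x => f x * χ (((R : ℝ) + 1)⁻¹ * x)) x ∂μ) atTop
      (𝓝 (∫ x, v x * iteratedDeriv m f x ∂μ)) := by
  choose C hC using fun j : ℕ => hsupp.exists_bound_iteratedDeriv (hχ j)
  have hlim : Tendsto (fun R : ℕ => ((R : ℝ) + 1)⁻¹) atTop (𝓝 0) := by
    simpa using tendsto_one_div_add_atTop_nhds_zero_nat (𝕜 := ℝ)
  refine tendsto_integral_of_dominated_convergence
    (fun x => ∑ i ∈ Finset.range (m + 1), m.choose i * ‖v x * iteratedDeriv i f x‖ * C (m - i))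
    (fun R => (hv.mul ((contDiff_mul_cutoff hf (hχ m) _).continuous_iteratedDeriv m
      le_rfl)).aestronglyMeasurable)
    (integrable_finsetSum _ fun i hi =>
      ((hint i (Finset.mem_range_succ_iff.1 hi)).norm.const_mul _).mul_const _)
    (fun R => ae_of_all _ fun x => ?_) (ae_of_all _ fun x => ?_)
  · rw [iteratedDeriv_mul_cutoff hf hχ, Finset.mul_sum]
    refine (norm_sum_le _ _).trans (Finset.sum_le_sum fun i _ => ?_)
    have hc0 : 0 ≤ ((R : ℝ) + 1)⁻¹ := by positivity
    have hc1 : ((R : ℝ) + 1)⁻¹ ≤ 1 := inv_le_one_of_one_le₀ (by simp)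
    have hb : |((R : ℝ) + 1)⁻¹ ^ (m - i) * iteratedDeriv (m - i) χ (((R : ℝ) + 1)⁻¹ * x)|
        ≤ C (m - i) := by
      rw [abs_mul, abs_of_nonneg (pow_nonneg hc0 _)]
      exact (mul_le_of_le_one_left (abs_nonneg _) (pow_le_one₀ hc0 hc1)).trans (hC _ _)
    calc _ = m.choose i * ‖v x * iteratedDeriv i f x‖ *
          |((R : ℝ) + 1)⁻¹ ^ (m - i) * iteratedDeriv (m - i) χ (((R : ℝ) + 1)⁻¹ * x)| := by
          simp only [norm_mul, Real.norm_eq_abs, abs_mul, Nat.abs_cast]; ring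
      _ ≤ _ := by gcongr
  · have hterm (i : ℕ) (hi : i ∈ Finset.range (m + 1)) :
        Tendsto (fun R : ℕ => (m.choose i : ℝ) * iteratedDeriv i f x *
          (((R : ℝ) + 1)⁻¹ ^ (m - i) * iteratedDeriv (m - i) χ (((R : ℝ) + 1)⁻¹ * x))) atTop
          (𝓝 (m.choose i * iteratedDeriv i f x *
            (0 ^ (m - i) * iteratedDeriv (m - i) χ (0 * x)))) :=
      ((hlim.pow _).mul ((((hχ (m - i)).continuous_iteratedDeriv (m - i) le_rfl).tendsto _).comp
        (hlim.mul_const x))).const_mul _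
    have hsum := tendsto_finsetSum _ hterm
    simp_rw [iteratedDeriv_mul_cutoff hf hχ]
    refine Tendsto.const_mul _ ?_
    convert hsum using 2
    rw [Finset.sum_range_succ, Finset.sum_eq_zero fun i hi => ?_]
    · simp [hχ0]
    · have : m - i ≠ 0 := Nat.sub_ne_zero_of_lt (Finset.mem_range.1 hi)
      simp [this]

end CutOff

/-- The coefficients of `x * f⁽ᵐ⁾(x)` in `A₁ f(x)`. -/
noncomputable def steinLinearCoeff (s ρ : ℝ) : Fin 5 → ℝ :=
  ![1, s * (-4 * ρ), s ^ 2 * (6 * ρ ^ 2 - 2), s ^ 3 * (1 - ρ ^ 2) * (4 * ρ),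
    s ^ 4 * (1 - ρ ^ 2) ^ 2]

/-- The coefficients of `f⁽ᵐ⁾(x)` in `A₁ f(x)`, divided by `n s`, where `a = r_X`, `b = r_Y`. -/
noncomputable def steinConstCoeff (s a b ρ : ℝ) : Fin 4 → ℝ :=
  ![-(a * b) - ρ, s * (2 * ρ * a * b - a ^ 2 - b ^ 2 + 3 * ρ ^ 2 - 1),
    s ^ 2 * (ρ * (a ^ 2 + b ^ 2) - (1 + ρ ^ 2) * a * b + 3 * ρ * (1 - ρ ^ 2)),
    s ^ 3 * (1 - ρ ^ 2) * (1 - ρ ^ 2)]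

/-- The part of `A₁` whose coefficients are multiples of the space variable, divided by it. -/
noncomputable def steinLinearPart (s ρ : ℝ) (f : ℝ → ℝ) (x : ℝ) : ℝ :=
  ∑ m : Fin 5, steinLinearCoeff s ρ m * iteratedDeriv m f x

/-- The constant-coefficient part of `A₁`, divided by `n s`. -/
noncomputable def steinConstPart (s a b ρ : ℝ) (f : ℝ → ℝ) (x : ℝ) : ℝ :=
  ∑ m : Fin 4, steinConstCoeff s a b ρ m * iteratedDeriv m f x

lemma A1_eq {μX μY σX σY ρ : ℝ} (hσX : σX ≠ 0) (hσY : σY ≠ 0) {n : ℕ} (hn : n ≠ 0)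
    (f : ℝ → ℝ) (x : ℝ) :
    A1 n μX μY σX σY ρ f x = x * steinLinearPart (σX * σY / n) ρ f x
      + n * (σX * σY / n) * steinConstPart (σX * σY / n) (μX / σX) (μY / σY) ρ f x := by
  have hn' : (n : ℝ) ≠ 0 := Nat.cast_ne_zero.2 hn
  have hμ : μX * μY = n * (σX * σY / n) * (μX / σX * (μY / σY)) := by field_simp
  simp only [A1, steinLinearPart, steinConstPart, steinLinearCoeff, steinConstCoeff, hμ,
    Fin.sum_univ_succ, Fin.sum_univ_zero]
  simp
  ring

lemma continuous_and_bounded_sum {g : ℝ → ℝ} (hg : ContDiff ℝ 4 g)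
    (hb : ∀ m ≤ 4, ∃ C, ∀ x, |iteratedDeriv m g x| ≤ C) {k : ℕ} (hk : k ≤ 5) (α : Fin k → ℝ) :
    Continuous (fun x => ∑ m, α m * iteratedDeriv m g x) ∧
      ∃ C, ∀ x, |∑ m, α m * iteratedDeriv m g x| ≤ C := by
  have hm (m : Fin k) : (m : ℕ) ≤ 4 := by omega
  choose C hC using fun m : Fin k => hb m (hm m)
  refine ⟨continuous_finsetSum _ fun m _ => continuous_const.mul
    (hg.continuous_iteratedDeriv m (by exact_mod_cast hm m)), ∑ m, |α m| * C m, fun x => ?_⟩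
  refine (Finset.abs_sum_le_sum_abs _ _).trans (Finset.sum_le_sum fun m _ => ?_)
  rw [abs_mul]
  exact mul_le_mul_of_nonneg_left (hC m x) (abs_nonneg _)

section ProductNormal

variable (μX μY σX σY ρ : ℝ)

lemma continuous_PN_map : Continuous (fun p : ℝ × ℝ =>
    (μX + σX * p.1) * (μY + σY * (ρ * p.1 + Real.sqrt (1 - ρ ^ 2) * p.2))) := by
  fun_prop

instance : IsProbabilityMeasure (PN μX μY σX σY ρ) :=
  Measure.isProbabilityMeasure_map (continuous_PN_map μX μY σX σY ρ).aemeasurable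

lemma integrable_id_PN : Integrable (fun z => z) (PN μX μY σX σY ρ) := by
  rw [PN, integrable_map_measure measurable_id'.aestronglyMeasurable
    (continuous_PN_map μX μY σX σY ρ).aemeasurable]
  refine (integrable_affine_mul_affine_mul_bdd μX σX 0 μY (σY * ρ) (σY * Real.sqrt (1 - ρ ^ 2))
    (k := fun _ => 1) (C := 1) continuous_const (by simp)).congr (ae_of_all _ fun p => ?_)
  simp only [Function.comp]
  ring

variable {μX μY σX σY ρ} {n : ℕ} {g : ℝ → ℝ}

lemma integral_stein_PN (hσX : σX ≠ 0) (hσY : σY ≠ 0) (hρ : ρ ^ 2 ≤ 1)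
    (hg : ContDiff ℝ 4 g) (hb : ∀ m ≤ 4, ∃ C, ∀ x, |iteratedDeriv m g x| ≤ C) (w : ℝ) :
    ∫ z, (z / n * steinLinearPart (σX * σY / n) ρ g (z / n + w)
      + σX * σY / n * steinConstPart (σX * σY / n) (μX / σX) (μY / σY) ρ g (z / n + w))
      ∂PN μX μY σX σY ρ = 0 := by
  have hl : Continuous (steinLinearPart (σX * σY / n) ρ g) :=
    (continuous_and_bounded_sum hg hb le_rfl _).1
  have hc : Continuous (steinConstPart (σX * σY / n) (μX / σX) (μY / σY) ρ g) :=
    (continuous_and_bounded_sum hg hb (by norm_num) _).1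
  rw [PN, integral_map (continuous_PN_map μX μY σX σY ρ).aemeasurable
    (Continuous.aestronglyMeasurable (by fun_prop))]
  have key := integral_stein_gaussian_prod (a := μX / σX) (b := μY / σY) (s := σX * σY / n) (w := w)
    (Real.sq_sqrt (sub_nonneg.2 hρ)) hg hb
  refine Eq.trans ?_ ((congrArg (fun t => σX * σY / n * t) key).trans (mul_zero _))
  rw [← integral_const_mul]
  refine integral_congr_ae (ae_of_all _ fun p => ?_)
  have hz : (μX + σX * p.1) * (μY + σY * (ρ * p.1 + √(1 - ρ ^ 2) * p.2)) / n =
      σX * σY / n * ((μX / σX + p.1) * (μY / σY + (ρ * p.1 + √(1 - ρ ^ 2) * p.2))) := by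
    field_simp
  simp only [hz, steinLinearPart, steinConstPart, steinLinearCoeff, steinConstCoeff,
    Fin.sum_univ_succ, Fin.sum_univ_zero]
  simp
  ring

lemma measurable_mean (n : ℕ) : Measurable (fun ω : Fin n → ℝ => (∑ i, ω i) / (n : ℝ)) := by
  fun_prop

instance : IsProbabilityMeasure (PNbar n μX μY σX σY ρ) :=
  Measure.isProbabilityMeasure_map (measurable_mean n).aemeasurable

lemma integrable_id_PNbar : Integrable (fun z => z) (PNbar n μX μY σX σY ρ) := by
  rw [PNbar, integrable_map_measure measurable_id'.aestronglyMeasurable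
    (measurable_mean n).aemeasurable]
  exact (integrable_finsetSum _ fun i _ =>
    integrable_comp_eval (i := i) (f := fun z => z) (integrable_id_PN μX μY σX σY ρ)).div_const _

lemma integral_pi_eq_zero_of_forall_integral_eq_zero {ν : Measure ℝ} [IsProbabilityMeasure ν]
    {m : ℕ} (i : Fin (m + 1)) {Φ : ℝ → ℝ → ℝ}
    (hΦ : ∀ w, ∫ z, Φ z (z + w) ∂ν = 0)
    (hi : Integrable (fun ω : Fin (m + 1) → ℝ => Φ (ω i) (∑ j, ω j)) (Measure.pi fun _ => ν)) :
    ∫ ω : Fin (m + 1) → ℝ, Φ (ω i) (∑ j, ω j) ∂(Measure.pi fun _ => ν) = 0 := by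
  have hmp := (measurePreserving_piFinSuccAbove (fun _ : Fin (m + 1) => ν) i).symm
  have hcomp (q : ℝ × (Fin m → ℝ)) :
      Φ ((MeasurableEquiv.piFinSuccAbove (fun _ => ℝ) i).symm q i)
        (∑ j, (MeasurableEquiv.piFinSuccAbove (fun _ => ℝ) i).symm q j) =
      Φ q.1 (q.1 + ∑ j, q.2 j) := by
    simp [Fin.sum_univ_succAbove _ i, MeasurableEquiv.piFinSuccAbove_symm_apply]
  rw [← hmp.integrable_comp_emb (MeasurableEquiv.measurableEmbedding _)] at hi
  rw [← hmp.integral_comp (MeasurableEquiv.measurableEmbedding _)]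
  simp only [Function.comp_def, hcomp] at hi ⊢
  rw [integral_prod_symm _ hi]
  simp [hΦ]

lemma integral_A1_PNbar_of_bounded (hσX : σX ≠ 0) (hσY : σY ≠ 0) (hρ : ρ ^ 2 ≤ 1) (hn : n ≠ 0)
    (hg : ContDiff ℝ 4 g) (hb : ∀ m ≤ 4, ∃ C, ∀ x, |iteratedDeriv m g x| ≤ C) :
    ∫ x, A1 n μX μY σX σY ρ g x ∂PNbar n μX μY σX σY ρ = 0 := by
  obtain ⟨hl, Cl, hCl⟩ : Continuous (steinLinearPart (σX * σY / n) ρ g) ∧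
      ∃ C, ∀ x, |steinLinearPart (σX * σY / n) ρ g x| ≤ C :=
    continuous_and_bounded_sum hg hb le_rfl _
  obtain ⟨hc, Cc, hCc⟩ :
      Continuous (steinConstPart (σX * σY / n) (μX / σX) (μY / σY) ρ g) ∧
      ∃ C, ∀ x, |steinConstPart (σX * σY / n) (μX / σX) (μY / σY) ρ g x| ≤ C :=
    continuous_and_bounded_sum hg hb (by norm_num) _
  simp_rw [A1_eq hσX hσY hn]
  rw [PNbar, integral_map (measurable_mean n).aemeasurable
    (Continuous.aestronglyMeasurable (by fun_prop))]
  let Φ : ℝ → ℝ → ℝ := fun z t => z / n * steinLinearPart (σX * σY / n) ρ g (t / n)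
      + σX * σY / n * steinConstPart (σX * σY / n) (μX / σX) (μY / σY) ρ g (t / n)
  have hsum (ω : Fin n → ℝ) :
      (∑ i, ω i) / n * steinLinearPart (σX * σY / n) ρ g ((∑ i, ω i) / n)
      + n * (σX * σY / n) *
        steinConstPart (σX * σY / n) (μX / σX) (μY / σY) ρ g ((∑ i, ω i) / n) =
      ∑ i, Φ (ω i) (∑ j, ω j) := by
    simp only [Φ, Finset.sum_add_distrib, ← Finset.sum_mul, ← Finset.sum_div, Finset.sum_const,
      Finset.card_univ, Fintype.card_fin, nsmul_eq_mul]
    ring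
  have hΦ (w : ℝ) : ∫ z, Φ z (z + w) ∂PN μX μY σX σY ρ = 0 := by
    simpa only [Φ, add_div] using integral_stein_PN hσX hσY hρ hg hb (n := n) (w / n)
  have hi (i : Fin n) : Integrable (fun ω : Fin n → ℝ => Φ (ω i) (∑ j, ω j))
      (Measure.pi fun _ => PN μX μY σX σY ρ) := by
    refine Integrable.add ?_ (Integrable.const_mul ?_ _)
    · exact ((integrable_comp_eval (i := i) (f := fun z => z)
        (integrable_id_PN μX μY σX σY ρ)).div_const _).mul_bdd
        (Continuous.aestronglyMeasurable (by fun_prop)) (ae_of_all _ fun ω => hCl _)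
    · exact Integrable.of_bound (Continuous.aestronglyMeasurable (by fun_prop)) Cc
        (ae_of_all _ fun ω => hCc _)
  simp_rw [hsum]
  rw [integral_finsetSum _ fun i _ => hi i]
  refine Finset.sum_eq_zero fun i _ => ?_
  obtain ⟨m, rfl⟩ := Nat.exists_eq_succ_of_ne_zero hn
  exact integral_pi_eq_zero_of_forall_integral_eq_zero i hΦ (hi i)

lemma integral_A1_eq_sum {ν : Measure ℝ} (hσX : σX ≠ 0) (hσY : σY ≠ 0) (hn : n ≠ 0)
    (hint : ∀ m ≤ 3, Integrable (fun x => 1 * iteratedDeriv m g x) ν)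
    (hintx : ∀ m ≤ 4, Integrable (fun x => x * iteratedDeriv m g x) ν) :
    ∫ x, A1 n μX μY σX σY ρ g x ∂ν =
      ∑ m : Fin 5, steinLinearCoeff (σX * σY / n) ρ m * ∫ x, x * iteratedDeriv m g x ∂ν +
      n * (σX * σY / n) * ∑ m : Fin 4, steinConstCoeff (σX * σY / n) (μX / σX) (μY / σY) ρ m *
        ∫ x, 1 * iteratedDeriv m g x ∂ν := by
  have h5 (m : Fin 5) : (m : ℕ) ≤ 4 := by omega
  have h4 (m : Fin 4) : (m : ℕ) ≤ 3 := by omega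
  have hl := integrable_finsetSum Finset.univ fun (m : Fin 5) _ =>
    (hintx m (h5 m)).const_mul (steinLinearCoeff (σX * σY / n) ρ m)
  have hc := (integrable_finsetSum Finset.univ fun (m : Fin 4) _ =>
    (hint m (h4 m)).const_mul (steinConstCoeff (σX * σY / n) (μX / σX) (μY / σY) ρ m)).const_mul
    (n * (σX * σY / n))
  simp_rw [← integral_const_mul]
  rw [← integral_finsetSum _ fun (m : Fin 5) _ => (hintx m (h5 m)).const_mul _,
    ← integral_finsetSum _ fun (m : Fin 4) _ => (hint m (h4 m)).const_mul _, ← integral_const_mul,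
    ← integral_add hl hc]
  refine integral_congr_ae (ae_of_all _ fun x => ?_)
  simp only [A1_eq hσX hσY hn, steinLinearPart, steinConstPart, Finset.mul_sum, one_mul,
    mul_left_comm]

end ProductNormal

/-- Necessity part of the Stein characterisation for `Z̄ₙ`, the mean of `n` independent
`PN(μX, μY; σX², σY²; ρ)` random variables: for every `C⁴` function `f` with
`E|f⁽ᵐ⁾(Z̄ₙ)| < ∞` for `m = 0,1,2,3` and `E|Z̄ₙ f⁽ᵐ⁾(Z̄ₙ)| < ∞` for `m = 0,1,2,3,4`,
one has `E[A₁ f (Z̄ₙ)] = 0`. -/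
theorem stein_necessity_PNbar
    (μX μY σX σY ρ : ℝ) (hσX : 0 < σX) (hσY : 0 < σY)
    (hρ₁ : -1 < ρ) (hρ₂ : ρ < 1) (n : ℕ) (hn : 1 ≤ n)
    (f : ℝ → ℝ) (hf : ContDiff ℝ 4 f)
    (hint : ∀ m ≤ 3, Integrable (iteratedDeriv m f) (PNbar n μX μY σX σY ρ))
    (hintx : ∀ m ≤ 4, Integrable (fun x => x * iteratedDeriv m f x) (PNbar n μX μY σX σY ρ)) :
    ∫ x, A1 n μX μY σX σY ρ f x ∂(PNbar n μX μY σX σY ρ) = 0 := by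
  have hn0 : n ≠ 0 := Nat.one_le_iff_ne_zero.1 hn
  have hρ : ρ ^ 2 ≤ 1 := by nlinarith
  have hint' : ∀ m ≤ 3, Integrable (fun x => 1 * iteratedDeriv m f x) (PNbar n μX μY σX σY ρ) := by
    simpa only [one_mul] using hint
  obtain ⟨χ, hχ, hsupp, hχ0⟩ := exists_smooth_cutoff
  let F : ℕ → ℝ → ℝ := fun R x => f x * χ (((R : ℝ) + 1)⁻¹ * x)
  have hF (R : ℕ) : ContDiff ℝ 4 (F R) := contDiff_mul_cutoff (m := 4) hf (hχ 4) _
  have hFsupp (R : ℕ) : HasCompactSupport (F R) :=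
    (hsupp.comp_homeomorph (Homeomorph.mulLeft₀ ((R : ℝ) + 1)⁻¹ (by positivity))).mul_left
  have hFb (R : ℕ) (m : ℕ) (hm : m ≤ 4) : ∃ C, ∀ x, |iteratedDeriv m (F R) x| ≤ C :=
    (hFsupp R).exists_bound_iteratedDeriv ((hF R).of_le (by exact_mod_cast hm))
  have hFc (R : ℕ) (m : ℕ) (hm : m ≤ 4) : Continuous (iteratedDeriv m (F R)) :=
    (hF R).continuous_iteratedDeriv m (by exact_mod_cast hm)
  have hFint (R : ℕ) : ∀ m ≤ 3, Integrable (fun x => 1 * iteratedDeriv m (F R) x)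
      (PNbar n μX μY σX σY ρ) := fun m hm =>
    (integrable_const 1).mul_bdd (hFc R m (by omega)).aestronglyMeasurable
      (ae_of_all _ (hFb R m (by omega)).choose_spec)
  have hFintx (R : ℕ) : ∀ m ≤ 4, Integrable (fun x => x * iteratedDeriv m (F R) x)
      (PNbar n μX μY σX σY ρ) := fun m hm =>
    integrable_id_PNbar.mul_bdd (hFc R m hm).aestronglyMeasurable
      (ae_of_all _ (hFb R m hm).choose_spec)
  have hlim : Filter.Tendsto (fun R => ∫ x, A1 n μX μY σX σY ρ (F R) x ∂PNbar n μX μY σX σY ρ)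
      Filter.atTop (nhds (∫ x, A1 n μX μY σX σY ρ f x ∂PNbar n μX μY σX σY ρ)) := by
    rw [integral_A1_eq_sum hσX.ne' hσY.ne' hn0 hint' hintx]
    refine (Filter.tendsto_congr fun R => integral_A1_eq_sum hσX.ne' hσY.ne' hn0 (hFint R)
      (hFintx R)).2 ?_
    refine (tendsto_finsetSum _ fun m _ => Filter.Tendsto.const_mul _ ?_).add
      ((tendsto_finsetSum _ fun m _ => Filter.Tendsto.const_mul _ ?_).const_mul _)
    · have hm : (m : ℕ) ≤ 4 := by omega
      exact tendsto_integral_mul_iteratedDeriv_cutoff continuous_id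
        (hf.of_le (by exact_mod_cast hm)) hχ hsupp hχ0 fun j hj => hintx j (hj.trans hm)
    · have hm : (m : ℕ) ≤ 3 := by omega
      exact tendsto_integral_mul_iteratedDeriv_cutoff continuous_const
        (hf.of_le (by exact_mod_cast hm.trans (by norm_num))) hχ hsupp hχ0
        fun j hj => hint' j (hj.trans hm)
  exact tendsto_nhds_unique hlim (tendsto_const_nhds.congr fun R =>
    (integral_A1_PNbar_of_bounded hσX.ne' hσY.ne' hρ hn0 (hF R) (hFb R)).symm)
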